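/- Let x̂ be a basic maximum-weight fractional matching and y a minimum fractional w-vertex cover in a weighted graph G. Let P be a tight M(x̂)-alternating path connecting two distinct odd cycles C_i, C_j ∈ 𝒞(x̂), with endpoints u = V(P)∩V(C_i) and v = V(P)∩V(C_j). Then the vector x̄ obtained from x̂ by alternate rounding on C_i at u, alternate rounding on C_j at v, and complementing on P, is a basic maximum-weight fractional matching of G with 𝒞(x̄) = 𝒞(x̂)∖{C_i, C_j}. -/

import Mathlib

namespace Stabilizer

variable {V : Type*} [Fintype V] [DecidableEq V]

/-- The set of vertices covered by a finite set of edges. -/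
def edgeVerts (C : Finset (Sym2 V)) : Set V := {v | ∃ e ∈ C, v ∈ e}

/-- A matching of `G`, given as a finite set of pairwise vertex-disjoint edges. -/
def IsMatching (G : SimpleGraph V) (M : Finset (Sym2 V)) : Prop :=
  (↑M ⊆ G.edgeSet) ∧ ∀ e ∈ M, ∀ f ∈ M, e ≠ f → ∀ v : V, v ∈ e → v ∉ f

/-- The total weight of a finite set of edges. -/
noncomputable def setWeight (w : Sym2 V → ℝ) (M : Finset (Sym2 V)) : ℝ := ∑ e ∈ M, w e

/-- ν(G): the maximum weight of a matching of `G`. -/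
noncomputable def nu (G : SimpleGraph V) (w : Sym2 V → ℝ) : ℝ :=
  sSup {r : ℝ | ∃ M : Finset (Sym2 V), IsMatching G M ∧ r = setWeight w M}

/-- A fractional matching of `G`. -/
def IsFracMatching (G : SimpleGraph V) (x : Sym2 V → ℝ) : Prop :=
  (∀ e, 0 ≤ x e) ∧ (∀ e, e ∉ G.edgeSet → x e = 0) ∧ ∀ v : V, ∑ u : V, x s(v, u) ≤ 1

/-- The weight of a fractional matching. -/
noncomputable def fracWeight (w x : Sym2 V → ℝ) : ℝ := ∑ e : Sym2 V, w e * x e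

/-- ν_f(G): the maximum weight of a fractional matching of `G`. -/
noncomputable def nuf (G : SimpleGraph V) (w : Sym2 V → ℝ) : ℝ :=
  sSup {r : ℝ | ∃ x : Sym2 V → ℝ, IsFracMatching G x ∧ r = fracWeight w x}

/-- A maximum-weight fractional matching of `G`. -/
def IsMaxFracMatching (G : SimpleGraph V) (w x : Sym2 V → ℝ) : Prop :=
  IsFracMatching G x ∧ ∀ y : Sym2 V → ℝ, IsFracMatching G y → fracWeight w y ≤ fracWeight w x

/-- All entries lie in {0, 1/2, 1}. -/
def IsHalfIntegral (x : Sym2 V → ℝ) : Prop := ∀ e, x e = 0 ∨ x e = 1 / 2 ∨ x e = 1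

/-- `C` is the edge set of an odd cycle of `G`. -/
def IsOddCycleEdgeSet (G : SimpleGraph V) (C : Finset (Sym2 V)) : Prop :=
  ∃ (v : V) (c : G.Walk v v), c.IsCycle ∧ Odd c.length ∧ c.edges.toFinset = C

/-- `F` is the family 𝒞(x) of vertex-disjoint odd cycles carrying exactly the
half-valued edges of `x`. -/
def IsCycleFamily (G : SimpleGraph V) (x : Sym2 V → ℝ) (F : Finset (Finset (Sym2 V))) : Prop :=
  (∀ C ∈ F, IsOddCycleEdgeSet G C) ∧
  (∀ C ∈ F, ∀ D ∈ F, C ≠ D → Disjoint (edgeVerts C) (edgeVerts D)) ∧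
  (∀ e : Sym2 V, x e = 1 / 2 ↔ ∃ C ∈ F, e ∈ C)

/-- A basic fractional matching of `G`. -/
def IsBasic (G : SimpleGraph V) (x : Sym2 V → ℝ) : Prop :=
  IsFracMatching G x ∧ IsHalfIntegral x ∧ ∃ F, IsCycleFamily G x F

/-- γ(G): the minimum number of odd cycles in the support of a basic
maximum-weight fractional matching of `G`. -/
noncomputable def gamma (G : SimpleGraph V) (w : Sym2 V → ℝ) : ℕ :=
  sInf {n : ℕ | ∃ (x : Sym2 V → ℝ) (F : Finset (Finset (Sym2 V))),
    IsMaxFracMatching G w x ∧ IsHalfIntegral x ∧ IsCycleFamily G x F ∧ F.card = n}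

/-- `G` is stable: ν(G) = ν_f(G). -/
def IsStable (G : SimpleGraph V) (w : Sym2 V → ℝ) : Prop := nu G w = nuf G w

/-- Deletion of a set of vertices (as the spanning subgraph obtained by
removing all edges incident to `S`; matchings, fractional matchings and covers
of `G∖S` correspond to those of this graph). -/
def deleteVerts (G : SimpleGraph V) (S : Set V) : SimpleGraph V where
  Adj a b := G.Adj a b ∧ a ∉ S ∧ b ∉ S
  symm := ⟨fun _ _ h => ⟨h.1.symm, h.2.2, h.2.1⟩⟩
  loopless := ⟨fun a h => G.loopless.irrefl a h.1⟩

/-- A fractional w-vertex cover of `G`. -/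
def IsFracCover (G : SimpleGraph V) (w : Sym2 V → ℝ) (y : V → ℝ) : Prop :=
  (∀ v, 0 ≤ y v) ∧ ∀ a b : V, G.Adj a b → w s(a, b) ≤ y a + y b

noncomputable def coverValue (y : V → ℝ) : ℝ := ∑ v : V, y v

/-- A minimum fractional w-vertex cover of `G`. -/
def IsMinFracCover (G : SimpleGraph V) (w : Sym2 V → ℝ) (y : V → ℝ) : Prop :=
  IsFracCover G w y ∧ ∀ z : V → ℝ, IsFracCover G w z → coverValue y ≤ coverValue z

/-- M(x): the 1-valued edges of `x`. -/
noncomputable def oneEdges (x : Sym2 V → ℝ) : Finset (Sym2 V) :=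
  Finset.univ.filter fun e => x e = 1

/-- `v` is exposed by the matching `M`. -/
def MExposed (M : Finset (Sym2 V)) (v : V) : Prop := ∀ e ∈ M, v ∉ e

/-- A list of edges alternately in and out of `M`. -/
def AltList (M : Finset (Sym2 V)) (l : List (Sym2 V)) : Prop :=
  l.Chain' fun e f => (e ∈ M ↔ f ∉ M)

variable {G : SimpleGraph V}

/-- An M-alternating walk. -/
def IsAltWalk (M : Finset (Sym2 V)) {a b : V} (p : G.Walk a b) : Prop := AltList M p.edges

/-- A valid walk: it starts (resp. ends) with an M-exposed vertex or an edge of `M`. -/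
def IsValidWalk (M : Finset (Sym2 V)) {a b : V} (p : G.Walk a b) : Prop :=
  (MExposed M a ∨ ∃ e ∈ M, p.edges.head? = some e) ∧
  (MExposed M b ∨ ∃ e ∈ M, p.edges.getLast? = some e)

/-- w(P ∩ M), with multiplicity. -/
noncomputable def wIn (w : Sym2 V → ℝ) (M : Finset (Sym2 V)) (l : List (Sym2 V)) : ℝ :=
  (l.map fun e => if e ∈ M then w e else 0).sum

/-- w(P ∖ M), with multiplicity. -/
noncomputable def wOut (w : Sym2 V → ℝ) (M : Finset (Sym2 V)) (l : List (Sym2 V)) : ℝ :=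
  (l.map fun e => if e ∈ M then 0 else w e).sum

/-- An M-augmenting walk. -/
def IsAugWalk (w : Sym2 V → ℝ) (M : Finset (Sym2 V)) {a b : V} (p : G.Walk a b) : Prop :=
  IsAltWalk M p ∧ IsValidWalk M p ∧ wIn w M p.edges < wOut w M p.edges

/-- An M-augmenting path. -/
def IsAugPath (w : Sym2 V → ℝ) (M : Finset (Sym2 V)) {a b : V} (p : G.Walk a b) : Prop :=
  p.IsPath ∧ IsAugWalk w M p

/-- An M-alternating cycle (an even cycle alternately in and out of `M`). -/
def IsAltCycle (M : Finset (Sym2 V)) {a : V} (c : G.Walk a a) : Prop :=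
  c.IsCycle ∧ Even c.length ∧ AltList M c.edges ∧
  ∀ e f : Sym2 V, c.edges.head? = some e → c.edges.getLast? = some f → (e ∈ M ↔ f ∉ M)

/-- An M-augmenting cycle. -/
def IsAugCycle (w : Sym2 V → ℝ) (M : Finset (Sym2 V)) {a : V} (c : G.Walk a a) : Prop :=
  IsAltCycle M c ∧ wIn w M c.edges < wOut w M c.edges

/-- An M-blossom with base `a` (traversed starting and ending at its base). -/
def IsBlossom (M : Finset (Sym2 V)) {a : V} (c : G.Walk a a) : Prop :=
  c.IsCycle ∧ Odd c.length ∧ AltList M c.edges ∧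
  ∀ e : Sym2 V, c.edges.head? = some e → e ∉ M

/-- An M-flower: an M-blossom `c` with base `a` together with a valid M-alternating
path `p` from the base `a` to the root `r`, starting with an edge of `M`. -/
def IsFlower (M : Finset (Sym2 V)) {a r : V} (c : G.Walk a a) (p : G.Walk a r) : Prop :=
  IsBlossom M c ∧ p.IsPath ∧ AltList M p.edges ∧
  (∃ e ∈ M, p.edges.head? = some e) ∧
  (MExposed M r ∨ ∃ e ∈ M, p.edges.getLast? = some e)

/-- An M-augmenting flower (with root `r`). -/
def IsAugFlower (w : Sym2 V → ℝ) (M : Finset (Sym2 V)) {a r : V}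
    (c : G.Walk a a) (p : G.Walk a r) : Prop :=
  IsFlower M c p ∧
  wIn w M c.edges + 2 * wIn w M p.edges < wOut w M c.edges + 2 * wOut w M p.edges

/-- An M-bi-cycle: two M-blossoms `c`, `d` with bases `a`, `b` joined by an odd
M-alternating path `p` starting and ending with edges of `M`. -/
def IsBicycle (M : Finset (Sym2 V)) {a b : V}
    (c : G.Walk a a) (p : G.Walk a b) (d : G.Walk b b) : Prop :=
  IsBlossom M c ∧ IsBlossom M d ∧ p.IsPath ∧ Odd p.length ∧ AltList M p.edges ∧
  (∃ e ∈ M, p.edges.head? = some e) ∧ (∃ e ∈ M, p.edges.getLast? = some e)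

/-- An M-augmenting bi-cycle. -/
def IsAugBicycle (w : Sym2 V → ℝ) (M : Finset (Sym2 V)) {a b : V}
    (c : G.Walk a a) (p : G.Walk a b) (d : G.Walk b b) : Prop :=
  IsBicycle M c p d ∧
  wIn w M c.edges + 2 * wIn w M p.edges + wIn w M d.edges <
    wOut w M c.edges + 2 * wOut w M p.edges + wOut w M d.edges

/-- All edges of the walk are tight with respect to the fractional vertex cover `y`. -/
def IsTightWalk (w : Sym2 V → ℝ) (y : V → ℝ) {a b : V} (p : G.Walk a b) : Prop :=
  ∀ d ∈ p.darts, y d.toProd.1 + y d.toProd.2 = w s(d.toProd.1, d.toProd.2)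

/-- `x'` is the result of alternate rounding on the odd cycle with edge set `C`
at the vertex `u`: on `C` it is 0/1-valued, both edges of `C` at `u` get value 0,
and its 1-valued edges inside `C` perfectly match the remaining vertices of `C`. -/
def AltRoundedOn (x' : Sym2 V → ℝ) (C : Finset (Sym2 V)) (u : V) : Prop :=
  (∀ e ∈ C, x' e = 0 ∨ x' e = 1) ∧ (∀ e ∈ C, u ∈ e → x' e = 0) ∧
  ∀ z ∈ edgeVerts C, z ≠ u → ∃! e : Sym2 V, e ∈ C ∧ x' e = 1 ∧ z ∈ e

theorem sum_sym2_eq_sum_incident (x : Sym2 V → ℝ) (v : V) :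
    ∑ u : V, x s(v, u) = ∑ e with v ∈ e, x e := by
  have h : (Finset.univ.filter fun e : Sym2 V => v ∈ e) = Finset.univ.image fun u => s(v, u) := by
    ext e
    simp [Sym2.mem_iff_exists, eq_comm]
  rw [h, Finset.sum_image]
  intro a _ b _ hab
  exact Sym2.congr_right.1 hab

/-- The sum of the values of `y` over the ends of an edge. -/
def endSum (y : V → ℝ) (e : Sym2 V) : ℝ := ∑ v with v ∈ e, y v

theorem endSum_mk (y : V → ℝ) {a b : V} (hab : a ≠ b) : endSum y s(a, b) = y a + y b := by
  have h : (Finset.univ.filter fun v => v ∈ s(a, b)) = {a, b} := by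
    ext v
    simp
  rw [endSum, h, Finset.sum_pair hab]

theorem sum_endSum_mul (y : V → ℝ) (x : Sym2 V → ℝ) :
    ∑ e, endSum y e * x e = ∑ v, y v * ∑ u, x s(v, u) := by
  simp only [sum_sym2_eq_sum_incident, endSum, Finset.sum_mul, Finset.mul_sum, Finset.sum_filter,
    ite_mul, zero_mul]
  rw [Finset.sum_comm]
  simp

/-- LP duality: a fractional cover of value at most the maximum weight of a fractional matching. -/
theorem exists_isFracCover_le {w x : Sym2 V → ℝ} (hx : IsMaxFracMatching G w x) :
    ∃ y, IsFracCover G w y ∧ coverValue y ≤ fracWeight w x := by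
  set W := fracWeight w x with hW
  let deg : (Sym2 V → ℝ) → V → ℝ := fun z v => ∑ u, z s(v, u)
  let U : Set ((V → ℝ) × ℝ) := (Set.univ.pi fun _ => Set.Iio 1) ×ˢ Set.Ioi W
  let K : Set ((V → ℝ) × ℝ) := {q | ∃ z : Sym2 V → ℝ, (∀ e, 0 ≤ z e) ∧
    (∀ e, e ∉ G.edgeSet → z e = 0) ∧ q = (deg z, fracWeight w z)}
  have hUconv : Convex ℝ U := (convex_pi fun _ _ => convex_Iio 1).prod (convex_Ioi W)
  have hUopen : IsOpen U := (isOpen_set_pi Set.finite_univ fun _ _ => isOpen_Iio).prod isOpen_Ioi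
  have hKconv : Convex ℝ K := by
    rintro _ ⟨z, hz, hz', rfl⟩ _ ⟨z', hw, hw', rfl⟩ s t hs ht _
    refine ⟨fun e => s * z e + t * z' e, fun e => ?_, fun e he => ?_, ?_⟩
    · exact add_nonneg (mul_nonneg hs (hz e)) (mul_nonneg ht (hw e))
    · simp [hz' e he, hw' e he]
    · ext v
      · simp [deg, Finset.sum_add_distrib, Finset.mul_sum]
      · simp only [fracWeight, Prod.smul_mk, Prod.mk_add_mk, smul_eq_mul, Finset.mul_sum,
          ← Finset.sum_add_distrib]
        exact Finset.sum_congr rfl fun e _ => by ring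
  have hdisj : Disjoint U K := by
    rw [Set.disjoint_left]
    rintro _ ⟨h1, h2⟩ ⟨z, hz, hz', rfl⟩
    exact absurd (hx.2 z ⟨hz, hz', fun v => (h1 v trivial).le⟩) (not_le.2 h2)
  obtain ⟨f, s, hfU, hfK⟩ := geometric_hahn_banach_open hUconv hUopen hKconv hdisj
  have hs : s ≤ 0 := by
    have := hfK (deg 0, fracWeight w 0) ⟨0, by simp, by simp, rfl⟩
    have h0 : ((deg 0, fracWeight w 0) : (V → ℝ) × ℝ) = 0 := by
      ext <;> simp [deg, fracWeight]
    rwa [h0, map_zero] at this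
  let α : V → ℝ := fun v => f (Pi.single v 1, 0)
  let β : ℝ := - f (0, 1)
  have hf : ∀ (z : V → ℝ) (t : ℝ), f (z, t) = ∑ v, α v * z v - β * t := by
    intro z t
    have : (z, t) = ∑ v, z v • ((Pi.single v 1, 0) : (V → ℝ) × ℝ) + t • ((0, 1) : (V → ℝ) × ℝ) := by
      ext v
      · simp [Prod.fst_sum, Finset.sum_apply, Pi.single_apply]
      · simp [Prod.snd_sum]
    rw [this, map_add, map_sum, map_smul]
    simp only [map_smul, smul_eq_mul, α, β]
    simp only [mul_comm]
    ring
  have hneg : ∀ (z : V → ℝ) (t : ℝ), (∀ v, z v < 1) → W < t → ∑ v, α v * z v - β * t < 0 := by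
    intro z t hz ht
    rw [← hf]
    exact (hfU (z, t) ⟨fun v _ => hz v, ht⟩).trans_le hs
  have hα : ∀ v, 0 ≤ α v := by
    intro v
    by_contra! h
    have key := fun r (hr : r < 1) => hneg (Pi.single v r) (W + 1)
      (fun u => by by_cases huv : u = v <;> simp [huv, hr]) (by linarith)
    simp only [Pi.single_apply, mul_ite, mul_zero, Finset.sum_ite_eq', Finset.mem_univ,
      if_true] at key
    have h1 := key (-(|β * (W + 1)| / (-α v))) ((neg_nonpos.2 (by
      have := neg_pos.2 h
      positivity)).trans_lt one_pos)
    have h2 : α v * -(|β * (W + 1)| / (-α v)) = |β * (W + 1)| := by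
      have := h.ne
      field_simp
    rw [h2] at h1
    linarith [le_abs_self (β * (W + 1))]
  have hβ0 : 0 ≤ β := by
    by_contra! h
    have h1 := hneg 0 (|W| + 1) (by simp) (by linarith [le_abs_self W])
    simp only [Pi.zero_apply, mul_zero, Finset.sum_const_zero, zero_sub] at h1
    nlinarith [abs_nonneg W]
  have hβ : 0 < β := by
    refine hβ0.lt_of_ne fun h => ?_
    have h1 := hneg 0 (W + 1) (by simp) (by linarith)
    simp [← h] at h1
  refine ⟨fun v => α v / β, ⟨fun v => div_nonneg (hα v) hβ.le, fun a b hab => ?_⟩, ?_⟩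
  · by_contra! hlt
    have hne := hab.ne
    have key : ∀ r : ℝ, 0 ≤ r → s ≤ r * (α a + α b - β * w s(a, b)) := by
      intro r hr
      have h := hfK _ ⟨Pi.single s(a, b) r, fun e => ?_, fun e he => ?_, rfl⟩
      · rw [hf] at h
        have h1 := sum_endSum_mul α (Pi.single s(a, b) r)
        have h2 : fracWeight w (Pi.single s(a, b) r) = w s(a, b) * r := by
          simp [fracWeight, Pi.single_apply]
        rw [h2, ← h1] at h
        simp only [Pi.single_apply, mul_ite, mul_zero, Finset.sum_ite_eq', Finset.mem_univ,
          if_true, endSum_mk α hne] at h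
        linarith
      · by_cases hee : e = s(a, b) <;> simp [hee, hr]
      · have : e ≠ s(a, b) := by
          rintro rfl
          exact he hab
        simp [this]
    have hm : α a + α b - β * w s(a, b) < 0 := by
      rw [← add_div, div_lt_iff₀ hβ] at hlt
      linarith
    set m := α a + α b - β * w s(a, b)
    have h1 := key ((s - 1) / m) (div_nonneg_of_nonpos (by linarith) hm.le)
    rw [div_mul_cancel₀ _ hm.ne] at h1
    linarith
  · simp only [coverValue, ← Finset.sum_div]
    rw [div_le_iff₀ hβ]
    refine le_of_forall_pos_lt_add fun ε hε => ?_
    have hA : 0 ≤ ∑ v, α v := Finset.sum_nonneg fun v _ => hα v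
    have hpos : 0 < ∑ v, α v + β := by linarith
    set δ := ε / (∑ v, α v + β) with hδ
    have hδ0 : 0 < δ := div_pos hε hpos
    have h1 := hneg (fun _ => 1 - δ) (W + δ) (fun _ => by linarith) (by linarith)
    rw [← Finset.sum_mul] at h1
    have h2 : δ * (∑ v, α v + β) = ε := div_mul_cancel₀ _ hpos.ne'
    linarith

/-- Value of a minimum fractional cover. -/
theorem IsMinFracCover.coverValue_le {w x : Sym2 V → ℝ} {y : V → ℝ}
    (hy : IsMinFracCover G w y) (hx : IsMaxFracMatching G w x) :
    coverValue y ≤ fracWeight w x := by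
  obtain ⟨z, hz, hzw⟩ := exists_isFracCover_le hx
  exact (hy.2 z hz).trans hzw

theorem IsFracCover.le_endSum {w : Sym2 V → ℝ} {y : V → ℝ} (hy : IsFracCover G w y)
    {e : Sym2 V} (he : e ∈ G.edgeSet) : w e ≤ endSum y e := by
  induction e with
  | _ a b =>
    rw [SimpleGraph.mem_edgeSet] at he
    rw [endSum_mk y he.ne]
    exact hy.2 a b he

/-- Complementary slackness for edges. -/
theorem IsMinFracCover.endSum_mul_eq {w x : Sym2 V → ℝ} {y : V → ℝ}
    (hy : IsMinFracCover G w y) (hx : IsMaxFracMatching G w x) (e : Sym2 V) :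
    w e * x e = endSum y e * x e := by
  have hle : ∀ e ∈ Finset.univ, w e * x e ≤ endSum y e * x e := by
    intro e _
    by_cases he : e ∈ G.edgeSet
    · exact mul_le_mul_of_nonneg_right (hy.1.le_endSum he) (hx.1.1 e)
    · simp [hx.1.2.1 e he]
  refine (Finset.sum_eq_sum_iff_of_le hle).1 (le_antisymm (Finset.sum_le_sum hle) ?_) e
    (Finset.mem_univ e)
  refine le_trans ?_ (hy.coverValue_le hx)
  rw [sum_endSum_mul]
  exact Finset.sum_le_sum fun v _ => mul_le_of_le_one_right (hy.1.1 v) (hx.1.2.2 v)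

/-- Every vertex of a cycle lies on two distinct edges of the cycle. -/
theorem IsOddCycleEdgeSet.exists_two_edges {V : Type*} [DecidableEq V] {G : SimpleGraph V}
    {C : Finset (Sym2 V)} (hC : IsOddCycleEdgeSet G C)
    {v : V} (hv : v ∈ edgeVerts C) :
    ∃ e ∈ C, ∃ f ∈ C, e ≠ f ∧ v ∈ e ∧ v ∈ f := by
  obtain ⟨u, c, hc, -, rfl⟩ := hC
  obtain ⟨e, he, hve⟩ := hv
  rw [List.mem_toFinset] at he
  have h2 := hc.ncard_neighborSet_toSubgraph_eq_two (c.mem_support_of_mem_edges he hve)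
  obtain ⟨p, q, hpq, hN⟩ := Set.ncard_eq_two.1 h2
  have hmem : ∀ z ∈ ({p, q} : Set V), s(v, z) ∈ c.edges := by
    intro z hz
    rw [← hN] at hz
    exact SimpleGraph.Walk.adj_toSubgraph_iff_mem_edges.1 hz
  refine ⟨s(v, p), ?_, s(v, q), ?_, fun h => hpq (Sym2.congr_right.1 h), ?_, ?_⟩ <;>
    simp [hmem]

theorem IsOddCycleEdgeSet.subset_edgeSet {V : Type*} [DecidableEq V] {G : SimpleGraph V}
    {C : Finset (Sym2 V)} (hC : IsOddCycleEdgeSet G C) :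
    (C : Set (Sym2 V)) ⊆ G.edgeSet := by
  obtain ⟨u, c, -, -, rfl⟩ := hC
  intro e he
  exact c.edges_subset_edgeSet (List.mem_toFinset.1 he)

theorem IsFracMatching.sum_incident_le {x : Sym2 V → ℝ} (hx : IsFracMatching G x) (v : V)
    (S : Finset (Sym2 V)) (hS : ∀ e ∈ S, v ∈ e) : ∑ e ∈ S, x e ≤ 1 := by
  refine le_trans ?_ ((sum_sym2_eq_sum_incident x v).symm.le.trans (hx.2.2 v))
  exact Finset.sum_le_sum_of_subset_of_nonneg (fun e he => by simp [hS e he])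
    fun e _ _ => hx.1 e

theorem IsFracMatching.eq_zero_of_eq_one {x : Sym2 V → ℝ} (hx : IsFracMatching G x) {v : V}
    {e f : Sym2 V} (hef : f ≠ e) (he : v ∈ e) (hf : v ∈ f) (h1 : x e = 1) : x f = 0 := by
  have h := hx.sum_incident_le v {e, f} (by simp [he, hf])
  rw [Finset.sum_pair hef.symm] at h
  linarith [hx.1 f]

section CycleFamily

variable {x : Sym2 V → ℝ} {F : Finset (Finset (Sym2 V))} {C : Finset (Sym2 V)} {v : V}

theorem IsCycleFamily.eq_zero_of_notMem (hF : IsCycleFamily G x F) (hx : IsFracMatching G x)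
    (hC : C ∈ F) (hv : v ∈ edgeVerts C) {g : Sym2 V} (hvg : v ∈ g) (hg : g ∉ C) : x g = 0 := by
  obtain ⟨e, he, f, hf, hef, hve, hvf⟩ := (hF.1 C hC).exists_two_edges hv
  have hge : g ≠ e := by rintro rfl; exact hg he
  have hgf : g ≠ f := by rintro rfl; exact hg hf
  have h := hx.sum_incident_le v {g, e, f} (by simp [hve, hvf, hvg])
  rw [Finset.sum_insert (by simp [hge, hgf]), Finset.sum_pair hef,
    (hF.2.2 e).2 ⟨C, hC, he⟩, (hF.2.2 f).2 ⟨C, hC, hf⟩] at h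
  linarith [hx.1 g]

theorem IsCycleFamily.sum_eq_one (hF : IsCycleFamily G x F) (hx : IsFracMatching G x)
    (hC : C ∈ F) (hv : v ∈ edgeVerts C) : ∑ u, x s(v, u) = 1 := by
  obtain ⟨e, he, f, hf, hef, hve, hvf⟩ := (hF.1 C hC).exists_two_edges hv
  refine le_antisymm (hx.2.2 v) ?_
  have h : ∑ g ∈ {e, f}, x g ≤ ∑ g with v ∈ g, x g :=
    Finset.sum_le_sum_of_subset_of_nonneg (by grind) fun g _ _ => hx.1 g
  rw [Finset.sum_pair hef, (hF.2.2 e).2 ⟨C, hC, he⟩, (hF.2.2 f).2 ⟨C, hC, hf⟩] at h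
  rw [sum_sym2_eq_sum_incident]
  linarith

theorem IsCycleFamily.ne_one (hF : IsCycleFamily G x F) (hx : IsFracMatching G x)
    (hC : C ∈ F) (hv : v ∈ edgeVerts C) {g : Sym2 V} (hvg : v ∈ g) : x g ≠ 1 := by
  by_cases hg : g ∈ C
  · rw [(hF.2.2 g).2 ⟨C, hC, hg⟩]
    norm_num
  · rw [hF.eq_zero_of_notMem hx hC hv hvg hg]
    norm_num

end CycleFamily

theorem sum_eq_one_of_forall_ne_eq_zero {x : Sym2 V → ℝ} {v : V} {e : Sym2 V} (hv : v ∈ e)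
    (he : x e = 1)
    (h : ∀ f, v ∈ f → f ≠ e → x f = 0) : ∑ u, x s(v, u) = 1 := by
  rw [sum_sym2_eq_sum_incident, Finset.sum_eq_single_of_mem e (by simp [hv]), he]
  intro f hf
  exact h f (by simpa using hf)

section Path

variable {V : Type*} {G : SimpleGraph V}

/-- The start of a nontrivial path lies on exactly one edge of the path. -/
theorem isPath_existsUnique_edge_start {a b : V} {p : G.Walk a b} (hp : p.IsPath) (hab : a ≠ b) :
    ∃! e, e ∈ p.edges ∧ a ∈ e := by
  cases p with
  | nil => exact absurd rfl hab
  | @cons _ c _ h q =>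
    rw [SimpleGraph.Walk.cons_isPath_iff] at hp
    refine ⟨s(a, c), ⟨by simp, Sym2.mem_mk_left a c⟩, ?_⟩
    rintro g ⟨hg, hag⟩
    rw [SimpleGraph.Walk.edges_cons, List.mem_cons] at hg
    exact hg.resolve_right fun hg => hp.2 (q.mem_support_of_mem_edges hg hag)

/-- An inner vertex of a path lies on exactly two edges of the path, which are consecutive. -/
theorem isPath_exists_edges_inner {R : Sym2 V → Sym2 V → Prop} {a b : V} {p : G.Walk a b}
    (hp : p.IsPath) (hR : p.edges.IsChain R) {z : V} (hz : z ∈ p.support) (hza : z ≠ a)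
    (hzb : z ≠ b) :
    ∃ e f, R e f ∧ e ≠ f ∧ ∀ g, (g ∈ p.edges ∧ z ∈ g) ↔ (g = e ∨ g = f) := by
  induction p with
  | nil => simp_all
  | @cons a c b h q ih =>
    rw [SimpleGraph.Walk.cons_isPath_iff] at hp
    rw [SimpleGraph.Walk.support_cons, List.mem_cons] at hz
    replace hz := hz.resolve_left hza
    by_cases hzc : z = c
    · subst hzc
      obtain ⟨f, ⟨hf, hzf⟩, huniq⟩ := isPath_existsUnique_edge_start hp.1 hzb
      cases q with
      | nil => exact absurd rfl hzb
      | @cons _ d _ h' q =>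
        have hfd : f = s(z, d) := (huniq _ ⟨by simp, by simp⟩).symm
        have hR' : R s(a, z) s(z, d) := by
          simp only [SimpleGraph.Walk.edges_cons] at hR
          exact (List.isChain_cons_cons.1 hR).1
        refine ⟨s(a, z), f, hfd ▸ hR', ?_, fun g => ⟨?_, ?_⟩⟩
        · rintro rfl
          exact hp.2 (SimpleGraph.Walk.mem_support_of_mem_edges hf (Sym2.mem_mk_left a z))
        · rintro ⟨hg, hzg⟩
          rw [SimpleGraph.Walk.edges_cons, List.mem_cons] at hg
          exact hg.imp_right fun hg => huniq g ⟨hg, hzg⟩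
        · rintro (rfl | rfl)
          · simp
          · exact ⟨List.mem_cons_of_mem _ hf, hzf⟩
    · obtain ⟨e, f, hef, hne, hiff⟩ := ih hp.1 (by
        rw [SimpleGraph.Walk.edges_cons] at hR
        exact hR.tail) hz hzc hzb
      refine ⟨e, f, hef, hne, fun g => ?_⟩
      rw [← hiff, SimpleGraph.Walk.edges_cons, List.mem_cons]
      refine ⟨?_, fun hg => ⟨Or.inr hg.1, hg.2⟩⟩
      rintro ⟨rfl | hg, hzg⟩
      · simp [hza, hzc] at hzg
      · exact ⟨hg, hzg⟩

end Path

theorem isAlt_exists_edges_inner {V : Type*} [Fintype V] {G : SimpleGraph V}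
    {x : Sym2 V → ℝ} {a b : V} {p : G.Walk a b}
    (hp : p.IsPath) (halt : AltList (oneEdges x) p.edges) {z : V} (hz : z ∈ p.support)
    (hza : z ≠ a) (hzb : z ≠ b) :
    ∃ e f, x e = 1 ∧ x f ≠ 1 ∧ ∀ g, (g ∈ p.edges ∧ z ∈ g) ↔ (g = e ∨ g = f) := by
  obtain ⟨e, f, hef, -, h⟩ := isPath_exists_edges_inner hp halt hz hza hzb
  simp only [oneEdges, Finset.mem_filter, Finset.mem_univ, true_and] at hef
  by_cases he : x e = 1
  · exact ⟨e, f, he, hef.1 he, h⟩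
  · exact ⟨f, e, by tauto, he, fun g => (h g).trans or_comm⟩

/-- Alternate rounding of a cycle at the start of a complemented path preserves the degree `1` of
its vertices. -/
theorem sum_eq_one_of_altRoundedOn {x x' : Sym2 V → ℝ} {F : Finset (Finset (Sym2 V))}
    (hx : IsFracMatching G x) (hF : IsCycleFamily G x F) {C D : Finset (Sym2 V)} (hC : C ∈ F)
    (hD : D ∈ F) (hCD : C ≠ D) {a b : V} {p : G.Walk a b} (hpath : p.IsPath) (hab : a ≠ b)
    (haC : {z : V | z ∈ p.support} ∩ edgeVerts C = {a}) (hround : AltRoundedOn x' C a)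
    (hcompl : ∀ e ∈ p.edges, x' e = 1 - x e)
    (hrest : ∀ e : Sym2 V, e ∉ C → e ∉ D → e ∉ p.edges → x' e = x e)
    {z : V} (hz : z ∈ edgeVerts C) : ∑ u, x' s(z, u) = 1 := by
  have hzD : ∀ e ∈ D, z ∉ e := fun e he hze =>
    Set.disjoint_left.1 (hF.2.1 C hC D hD hCD) hz ⟨e, he, hze⟩
  have hpC : ∀ v ∈ p.support, v ∈ edgeVerts C → v = a := fun v hv hvC =>
    haC.subset ⟨hv, hvC⟩
  by_cases hza : z = a
  · subst hza
    obtain ⟨e, ⟨he, hze⟩, huniq⟩ := isPath_existsUnique_edge_start hpath hab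
    have heC : e ∉ C := by
      intro heC
      induction e with
      | _ u v =>
        have hu := hpC u (p.fst_mem_support_of_mem_edges he) ⟨_, heC, Sym2.mem_mk_left u v⟩
        have hv := hpC v (p.snd_mem_support_of_mem_edges he) ⟨_, heC, Sym2.mem_mk_right u v⟩
        exact (p.adj_of_mem_edges he).ne (hu.trans hv.symm)
    refine sum_eq_one_of_forall_ne_eq_zero hze ?_ fun f hzf hfe => ?_
    · rw [hcompl e he, hF.eq_zero_of_notMem hx hC hz hze heC, sub_zero]
    · by_cases hfC : f ∈ C
      · exact hround.2.1 f hfC hzf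
      · rw [hrest f hfC (fun h => hzD f h hzf) fun h => hfe (huniq f ⟨h, hzf⟩)]
        exact hF.eq_zero_of_notMem hx hC hz hzf hfC
  · obtain ⟨e, ⟨heC, he1, hze⟩, huniq⟩ := hround.2.2 z hz hza
    refine sum_eq_one_of_forall_ne_eq_zero hze he1 fun f hzf hfe => ?_
    by_cases hfC : f ∈ C
    · exact (hround.1 f hfC).resolve_right fun h => hfe (huniq f ⟨hfC, h, hzf⟩)
    · rw [hrest f hfC (fun h => hzD f h hzf) fun h =>
        hza (hpC z (p.mem_support_of_mem_edges h hzf) hz)]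
      exact hF.eq_zero_of_notMem hx hC hz hzf hfC

/-- alternate rounding on the two cycles `C`, `D` at the endpoints of a
tight M(x)-alternating path `p` connecting them, and complementing on `p`, yields a
basic maximum-weight fractional matching whose cycle family is `F ∖ {C, D}`. -/
theorem round_and_complement
    {V : Type*} [Fintype V] [DecidableEq V]
    (G : SimpleGraph V) (w : Sym2 V → ℝ) (hw : ∀ e, 0 ≤ w e)
    (x : Sym2 V → ℝ) (F : Finset (Finset (Sym2 V)))
    (hx : IsMaxFracMatching G w x) (hhalf : IsHalfIntegral x)
    (hF : IsCycleFamily G x F)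
    (y : V → ℝ) (hy : IsMinFracCover G w y)
    (C D : Finset (Sym2 V)) (hC : C ∈ F) (hD : D ∈ F) (hCD : C ≠ D)
    (a b : V) (p : G.Walk a b)
    (hpath : p.IsPath) (halt : AltList (oneEdges x) p.edges)
    (htight : IsTightWalk w y p)
    (haC : {z : V | z ∈ p.support} ∩ edgeVerts C = {a})
    (hbD : {z : V | z ∈ p.support} ∩ edgeVerts D = {b})
    (x' : Sym2 V → ℝ)
    (hroundC : AltRoundedOn x' C a) (hroundD : AltRoundedOn x' D b)
    (hcompl : ∀ e ∈ p.edges, x' e = 1 - x e)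
    (hrest : ∀ e : Sym2 V, e ∉ C → e ∉ D → e ∉ p.edges → x' e = x e) :
    IsMaxFracMatching G w x' ∧ IsHalfIntegral x' ∧
    IsCycleFamily G x' (F \ {C, D}) := by

  have hxm := hx.1
  have hvC : ∀ z ∈ p.support, z ∈ edgeVerts C → z = a := fun z hz h => haC.subset ⟨hz, h⟩
  have hvD : ∀ z ∈ p.support, z ∈ edgeVerts D → z = b := fun z hz h => hbD.subset ⟨hz, h⟩
  have ha : a ∈ edgeVerts C := (haC.superset rfl).2
  have hb : b ∈ edgeVerts D := (hbD.superset rfl).2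
  have hdisj := Set.disjoint_left.1 (hF.2.1 C hC D hD hCD)
  have hab : a ≠ b := fun h => hdisj ha (h ▸ hb)
  have hpF : ∀ e ∈ p.edges, ∀ E ∈ F, e ∉ E := by
    intro e he E hE heE
    have hends : ∀ z ∈ e, z = a ∨ z = b := by
      intro z hz
      by_contra! h
      have hzE : z ∈ edgeVerts E := ⟨e, heE, hz⟩
      obtain ⟨f, _, hf, -, hfz⟩ := isAlt_exists_edges_inner hpath halt
        (p.mem_support_of_mem_edges he hz) h.1 h.2
      exact hF.ne_one hxm hE hzE ((hfz f).2 (Or.inl rfl)).2 hf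
    have hE_eq : ∀ B ∈ F, ∀ z ∈ e, z ∈ edgeVerts B → E = B := by
      intro B hB z hze hzB
      by_contra h
      exact Set.disjoint_left.1 (hF.2.1 E hE B hB h) ⟨e, heE, hze⟩ hzB
    induction e with
    | _ u v =>
      have huv := (p.adj_of_mem_edges he).ne
      have hu := hends u (Sym2.mem_mk_left u v)
      have hv := hends v (Sym2.mem_mk_right u v)
      have hae : a ∈ s(u, v) := by grind
      have hbe : b ∈ s(u, v) := by grind
      exact hCD ((hE_eq C hC a hae ha).symm.trans (hE_eq D hD b hbe hb))
  have hpx : ∀ e ∈ p.edges, x e = 0 ∨ x e = 1 := by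
    intro e he
    have h : x e ≠ 1 / 2 := fun h => by
      obtain ⟨E, hE, heE⟩ := (hF.2.2 e).1 h
      exact hpF e he E hE heE
    have := hhalf e
    tauto
  have hhalf' : IsHalfIntegral x' := by
    intro e
    by_cases heC : e ∈ C
    · have := hroundC.1 e heC
      tauto
    by_cases heD : e ∈ D
    · have := hroundD.1 e heD
      tauto
    by_cases hep : e ∈ p.edges
    · rw [hcompl e hep]
      rcases hpx e hep with h | h <;> simp [h]
    · rw [hrest e heC heD hep]
      exact hhalf e
  have hdeg : ∀ z, ∑ u, x' s(z, u) = ∑ u, x s(z, u) := by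
    intro z
    by_cases hzC : z ∈ edgeVerts C
    · rw [hF.sum_eq_one hxm hC hzC]
      exact sum_eq_one_of_altRoundedOn hxm hF hC hD hCD hpath hab haC hroundC hcompl hrest hzC
    by_cases hzD : z ∈ edgeVerts D
    · rw [hF.sum_eq_one hxm hD hzD]
      exact sum_eq_one_of_altRoundedOn (p := p.reverse) hxm hF hD hC hCD.symm hpath.reverse
        hab.symm (by simpa using hbD) hroundD (by simpa using hcompl)
        (fun e h1 h2 h3 => hrest e h2 h1 (by simpa using h3)) hzD
    have hstar : ∀ e, z ∈ e → e ∉ p.edges → x' e = x e := fun e hze hep =>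
      hrest e (fun h => hzC ⟨e, h, hze⟩) (fun h => hzD ⟨e, h, hze⟩) hep
    by_cases hzp : z ∈ p.support
    · obtain ⟨e, f, he, hf, hiff⟩ := isAlt_exists_edges_inner hpath halt hzp
        (fun h => hzC (h ▸ ha)) (fun h => hzD (h ▸ hb))
      obtain ⟨hep, hze⟩ := (hiff e).2 (Or.inl rfl)
      obtain ⟨hfp, hzf⟩ := (hiff f).2 (Or.inr rfl)
      have hzero : ∀ g, z ∈ g → g ≠ e → x g = 0 := fun g hzg hge =>
        hxm.eq_zero_of_eq_one hge hze hzg he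
      rw [sum_eq_one_of_forall_ne_eq_zero hze he hzero]
      refine sum_eq_one_of_forall_ne_eq_zero hzf ?_ fun g hzg hgf => ?_
      · rw [hcompl f hfp, (hpx f hfp).resolve_right hf, sub_zero]
      · by_cases hge : g = e
        · rw [hge, hcompl e hep, he, sub_self]
        · rw [hstar g hzg fun h => ((hiff g).1 ⟨h, hzg⟩).elim hge hgf]
          exact hzero g hzg hge
    · refine Finset.sum_congr rfl fun u _ => ?_
      exact hstar _ (Sym2.mem_mk_left z u) fun h => hzp (p.fst_mem_support_of_mem_edges h)
  have hfrac : IsFracMatching G x' := by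
    refine ⟨fun e => ?_, fun e he => ?_, fun v => (hdeg v).trans_le (hxm.2.2 v)⟩
    · rcases hhalf' e with h | h | h <;> simp [h]
    · rw [hrest e (fun h => he ((hF.1 C hC).subset_edgeSet h))
        (fun h => he ((hF.1 D hD).subset_edgeSet h)) (fun h => he (p.edges_subset_edgeSet h))]
      exact hxm.2.1 e he
  have htight_half : ∀ E ∈ F, ∀ e ∈ E, w e = endSum y e := by
    intro E hE e he
    have h := hy.endSum_mul_eq hx e
    rw [(hF.2.2 e).2 ⟨E, hE, he⟩] at h
    linarith
  have hslack : ∀ e, w e * x' e = endSum y e * x' e := by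
    intro e
    by_cases heC : e ∈ C
    · rw [htight_half C hC e heC]
    by_cases heD : e ∈ D
    · rw [htight_half D hD e heD]
    by_cases hep : e ∈ p.edges
    · obtain ⟨d, hd, rfl⟩ := List.mem_map.1 hep
      have h := htight d hd
      rw [← endSum_mk y d.adj.ne] at h
      exact congrArg (· * _) h.symm
    · rw [hrest e heC heD hep]
      exact hy.endSum_mul_eq hx e
  have hweight : fracWeight w x' = fracWeight w x := by
    simp only [fracWeight, hslack, hy.endSum_mul_eq hx, sum_endSum_mul, hdeg]
  refine ⟨⟨hfrac, fun z hz => (hx.2 z hz).trans_eq hweight.symm⟩, hhalf', ?_, ?_, ?_⟩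
  · exact fun E hE => hF.1 E (Finset.mem_sdiff.1 hE).1
  · exact fun E hE E' hE' => hF.2.1 E (Finset.mem_sdiff.1 hE).1 E' (Finset.mem_sdiff.1 hE').1
  · intro e
    have huniq : ∀ E ∈ F, ∀ E' ∈ F, e ∈ E → e ∈ E' → E = E' := by
      intro E hE E' hE' he he'
      by_contra h
      induction e with
      | _ u v =>
        exact Set.disjoint_left.1 (hF.2.1 E hE E' hE' h) ⟨_, he, Sym2.mem_mk_left u v⟩
          ⟨_, he', Sym2.mem_mk_left u v⟩
    simp only [Finset.mem_sdiff, Finset.mem_insert, Finset.mem_singleton, not_or]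
    constructor
    · intro h
      have heC : e ∉ C := fun he => by
        rcases hroundC.1 e he with h' | h' <;> norm_num [h'] at h
      have heD : e ∉ D := fun he => by
        rcases hroundD.1 e he with h' | h' <;> norm_num [h'] at h
      have hep : e ∉ p.edges := fun he => by
        rw [hcompl e he] at h
        rcases hpx e he with h' | h' <;> norm_num [h'] at h
      rw [hrest e heC heD hep] at h
      obtain ⟨E, hE, heE⟩ := (hF.2.2 e).1 h
      exact ⟨E, ⟨hE, fun h => heC (h ▸ heE), fun h => heD (h ▸ heE)⟩, heE⟩
    · rintro ⟨E, ⟨hE, hEC, hED⟩, heE⟩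
      rw [hrest e (fun h => hEC (huniq E hE C hC heE h)) (fun h => hED (huniq E hE D hD heE h))
        fun h => hpF e h E hE heE]
      exact (hF.2.2 e).2 ⟨E, hE, heE⟩

end Stabilizer
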